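/- Let A and B be standard rank-one ℂ[U]-modules. Then ord_U(coker(U₁ − U₂ : A ⊗_ℂ B → A ⊗_ℂ B)) ≥ max(ord_U(A), ord_U(B)); in particular ord_U(A ⊗̃ B) ≥ max(ord_U(A), ord_U(B)). -/

import Mathlib

open Polynomial TensorProduct

noncomputable section

/-- The action of `U` (i.e. multiplication by `X`) on a `ℂ[U]`-module,
as a `ℂ[U]`-linear endomorphism. -/
def Uact (M : Type) [AddCommGroup M] [Module (Polynomial ℂ) M] :
    M →ₗ[Polynomial ℂ] M :=
  LinearMap.lsmul (Polynomial ℂ) M Polynomial.X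

section Tensor

variable (A B : Type)
  [AddCommGroup A] [Module ℂ A] [Module (Polynomial ℂ) A] [IsScalarTower ℂ (Polynomial ℂ) A]
  [AddCommGroup B] [Module ℂ B] [Module (Polynomial ℂ) B] [IsScalarTower ℂ (Polynomial ℂ) B]

/-- `U₁ = (U•) ⊗ id` on `A ⊗[ℂ] B`, where `ℂ[U]` acts on `A ⊗[ℂ] B` through
the left factor. -/
def U₁ : A ⊗[ℂ] B →ₗ[Polynomial ℂ] A ⊗[ℂ] B :=
  TensorProduct.AlgebraTensorModule.map (Uact A) (LinearMap.id : B →ₗ[ℂ] B)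

/-- `U₂ = id ⊗ (U•)` on `A ⊗[ℂ] B`. -/
def U₂ : A ⊗[ℂ] B →ₗ[Polynomial ℂ] A ⊗[ℂ] B :=
  TensorProduct.AlgebraTensorModule.map (LinearMap.id : A →ₗ[Polynomial ℂ] A)
    ((Uact B).restrictScalars ℂ)

/-- `U₁ - U₂` as a `ℂ[U]`-linear endomorphism of `A ⊗[ℂ] B`. -/
def Udiff : A ⊗[ℂ] B →ₗ[Polynomial ℂ] A ⊗[ℂ] B := U₁ A B - U₂ A B

/-- `coker (U₁ - U₂)` as a `ℂ[U]`-module. -/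
abbrev CokerUdiff := (A ⊗[ℂ] B) ⧸ LinearMap.range (Udiff A B)

/-- `A ⊗̃ B = ker (U₁ - U₂) ⊕ coker (U₁ - U₂)` as a `ℂ[U]`-module. -/
abbrev TildeTensor := LinearMap.ker (Udiff A B) × CokerUdiff A B

end Tensor

/-- `ordSet M = {k | ∃ x ∈ M, U^k • x ≠ 0 ∧ U^(k+1) • x = 0}`. -/
def ordSet (M : Type) [AddCommGroup M] [Module (Polynomial ℂ) M] : Set ℕ :=
  {k | ∃ x : M, (Polynomial.X : Polynomial ℂ) ^ k • x ≠ 0 ∧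
    (Polynomial.X : Polynomial ℂ) ^ (k + 1) • x = 0}

/-- The torsion order `ord_U M = sSup (ordSet M)` (in `ℕ`, with `sSup ∅ = 0`). -/
def ordU (M : Type) [AddCommGroup M] [Module (Polynomial ℂ) M] : ℕ := sSup (ordSet M)

/-- A `ℂ[U]`-module is standard rank-one if it is finitely generated, its torsion
submodule is annihilated by a power of `U`, and the quotient by the torsion
submodule is isomorphic to `ℂ[U]`. -/
def StandardRankOne (M : Type) [AddCommGroup M] [Module (Polynomial ℂ) M] : Prop :=
  Module.Finite (Polynomial ℂ) M ∧
  (∃ n : ℕ, ∀ x ∈ Submodule.torsion (Polynomial ℂ) M, (Polynomial.X : Polynomial ℂ) ^ n • x = 0) ∧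
  Nonempty ((M ⧸ Submodule.torsion (Polynomial ℂ) M) ≃ₗ[Polynomial ℂ] Polynomial ℂ)

section OrdSet

variable {M N : Type} [AddCommGroup M] [Module (Polynomial ℂ) M]
  [AddCommGroup N] [Module (Polynomial ℂ) N]

lemma ordSet_subset_of_injective (f : M →ₗ[Polynomial ℂ] N) (hf : Function.Injective f) :
    ordSet M ⊆ ordSet N := by
  rintro k ⟨x, hx, hx'⟩
  refine ⟨f x, ?_, ?_⟩
  · rw [← map_smul]
    exact fun h => hx (hf (h.trans (map_zero f).symm))
  · rw [← map_smul, hx', map_zero]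

lemma ordU_le_of_injective (f : M →ₗ[Polynomial ℂ] N) (hf : Function.Injective f)
    (hN : BddAbove (ordSet N)) : ordU M ≤ ordU N := by
  rcases (ordSet M).eq_empty_or_nonempty with h | h
  · simp [ordU, h]
  · exact csSup_le_csSup hN h (ordSet_subset_of_injective f hf)

variable (M) in
lemma bddAbove_ordSet [IsNoetherian (Polynomial ℂ) M] : BddAbove (ordSet M) := by
  let K : ℕ →o Submodule (Polynomial ℂ) M :=
    ⟨fun n => LinearMap.ker (LinearMap.lsmul (Polynomial ℂ) M (X ^ n)),
      monotone_nat_of_le_succ fun n x hx => by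
        simp only [LinearMap.mem_ker, LinearMap.lsmul_apply] at hx ⊢
        rw [pow_succ', mul_smul, hx, smul_zero]⟩
  obtain ⟨n, hn⟩ := monotone_stabilizes_iff_noetherian.mpr ‹_› K
  refine ⟨n, fun k ⟨x, hx, hx'⟩ => ?_⟩
  by_contra! hk
  have h : K k = K (k + 1) := (hn k hk.le).symm.trans (hn (k + 1) (by omega))
  have hmem : x ∈ K (k + 1) := hx'
  rw [← h] at hmem
  exact hx hmem

lemma bddAbove_ordSet_prod {n : ℕ} (hM : ∀ x : M, (X : Polynomial ℂ) ^ n • x = 0)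
    (hN : BddAbove (ordSet N)) : BddAbove (ordSet (M × N)) := by
  obtain ⟨m, hm⟩ := hN
  refine ⟨max n m, fun k ⟨x, hx, hx'⟩ => ?_⟩
  by_contra! hk
  have hkn : n ≤ k := (le_max_left n m).trans hk.le
  have hfst : (X : Polynomial ℂ) ^ k • x.1 = 0 := by
    rw [← Nat.sub_add_cancel hkn, pow_add, mul_smul, hM, smul_zero]
  refine (lt_of_le_of_lt (le_max_right n m) hk).not_ge (hm ⟨x.2, fun h => hx ?_, ?_⟩)
  · exact Prod.ext hfst h
  · exact congrArg Prod.snd hx'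

end OrdSet

lemma StandardRankOne.exists_splitting {M : Type} [AddCommGroup M] [Module (Polynomial ℂ) M]
    (h : StandardRankOne M) :
    ∃ (φ : M →ₗ[Polynomial ℂ] Polynomial ℂ) (s : Polynomial ℂ →ₗ[Polynomial ℂ] M),
      (∀ p, φ (s p) = p) ∧ ∀ x, φ x = 0 → x ∈ Submodule.torsion (Polynomial ℂ) M := by
  obtain ⟨-, -, ⟨e⟩⟩ := h
  let φ := e.toLinearMap ∘ₗ (Submodule.torsion (Polynomial ℂ) M).mkQ
  have hφ : Function.Surjective φ := e.surjective.comp (Submodule.mkQ_surjective _)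
  obtain ⟨s, hs⟩ := Module.projective_lifting_property φ LinearMap.id hφ
  refine ⟨φ, s, fun p => LinearMap.congr_fun hs p, fun x hx => ?_⟩
  rw [← Submodule.Quotient.mk_eq_zero]
  exact e.map_eq_zero_iff.mp hx

lemma StandardRankOne.exists_injective_tensor_right (A : Type) {B : Type} [AddCommGroup A]
    [Module (Polynomial ℂ) A] [AddCommGroup B] [Module (Polynomial ℂ) B] (hB : StandardRankOne B) :
    ∃ f : A →ₗ[Polynomial ℂ] A ⊗[Polynomial ℂ] B, Function.Injective f := by
  obtain ⟨φ, s, hs, -⟩ := hB.exists_splitting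
  refine ⟨(TensorProduct.mk (Polynomial ℂ) A B).flip (s 1), Function.LeftInverse.injective
    (g := TensorProduct.rid (Polynomial ℂ) A ∘ φ.lTensor A) fun a => ?_⟩
  simp [hs]

section Tilde

variable (A B : Type)
  [AddCommGroup A] [Module ℂ A] [Module (Polynomial ℂ) A] [IsScalarTower ℂ (Polynomial ℂ) A]
  [AddCommGroup B] [Module ℂ B] [Module (Polynomial ℂ) B] [IsScalarTower ℂ (Polynomial ℂ) B]

variable {A B} in
@[simp]
lemma Udiff_tmul (a : A) (b : B) :
    Udiff A B (a ⊗ₜ b) = ((X : Polynomial ℂ) • a) ⊗ₜ b - a ⊗ₜ ((X : Polynomial ℂ) • b) :=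
  rfl

lemma range_Udiff : LinearMap.range (Udiff A B) =
    LinearMap.ker (TensorProduct.mapOfCompatibleSMul (Polynomial ℂ) ℂ (Polynomial ℂ) A B) := by
  apply le_antisymm
  · rintro _ ⟨x, rfl⟩
    induction x with
    | zero => simp
    | tmul a b => simp [TensorProduct.smul_tmul]
    | add x y hx hy => rw [map_add]; exact add_mem hx hy
  · rw [TensorProduct.AlgebraTensorModule.ker_mapOfCompatibleSMul, Submodule.span_le]
    rintro _ ⟨p, a, b, rfl⟩
    induction p using Polynomial.induction_on generalizing b with
    | C c =>
      have hC {M : Type} [AddCommGroup M] [Module ℂ M] [Module (Polynomial ℂ) M]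
          [IsScalarTower ℂ (Polynomial ℂ) M] (x : M) : (C c : Polynomial ℂ) • x = c • x :=
        algebraMap_smul (Polynomial ℂ) c x
      rw [hC, hC, TensorProduct.smul_tmul, sub_self]
      exact zero_mem _
    | add p q hp hq =>
      have : ((p + q) • a) ⊗ₜ[ℂ] b - a ⊗ₜ[ℂ] ((p + q) • b) =
          ((p • a) ⊗ₜ b - a ⊗ₜ (p • b)) + ((q • a) ⊗ₜ b - a ⊗ₜ (q • b)) := by
        rw [add_smul, add_smul, TensorProduct.add_tmul, TensorProduct.tmul_add]
        abel
      rw [this]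
      exact add_mem (hp b) (hq b)
    | monomial n c h =>
      have : ((C c * X ^ (n + 1)) • a) ⊗ₜ[ℂ] b - a ⊗ₜ[ℂ] ((C c * X ^ (n + 1)) • b) =
          Udiff A B (((C c * X ^ n) • a) ⊗ₜ b) +
            (((C c * X ^ n) • a) ⊗ₜ ((X : Polynomial ℂ) • b) -
              a ⊗ₜ ((C c * X ^ n) • (X : Polynomial ℂ) • b)) := by
        rw [Udiff_tmul, smul_smul, smul_smul, sub_add_sub_cancel]
        congr 3 <;> ring
      rw [this]
      exact add_mem ⟨_, rfl⟩ (h _)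

/-- The cokernel of `U₁ - U₂` is the tensor product over `ℂ[U]`. -/
def cokerUdiffEquiv : CokerUdiff A B ≃ₗ[Polynomial ℂ] A ⊗[Polynomial ℂ] B :=
  (Submodule.quotEquivOfEq _ _ (range_Udiff A B)).trans
    ((TensorProduct.mapOfCompatibleSMul (Polynomial ℂ) ℂ (Polynomial ℂ) A B).quotKerEquivOfSurjective
      (TensorProduct.mapOfCompatibleSMul_surjective _ _ _ _ _))

lemma Udiff_polynomial_injective : Function.Injective (Udiff (Polynomial ℂ) B) := by
  rw [injective_iff_map_eq_zero]
  intro x hx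
  let c := TensorProduct.equivFinsuppOfBasisLeft (N := B) (Polynomial.basisMonomials ℂ)
  have hc (y : Polynomial ℂ ⊗[ℂ] B) (k : ℕ) :
      c (Udiff (Polynomial ℂ) B y) (k + 1) = c y k - (X : Polynomial ℂ) • c y (k + 1) := by
    induction y with
    | zero => simp
    | tmul p b =>
      rw [Udiff_tmul, map_sub, Finsupp.sub_apply]
      simp only [c, TensorProduct.equivFinsuppOfBasisLeft_apply_tmul_apply]
      simp only [smul_eq_mul]
      change (X * p).coeff (k + 1) • b - p.coeff (k + 1) • (X : Polynomial ℂ) • b =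
        p.coeff k • b - (X : Polynomial ℂ) • p.coeff (k + 1) • b
      rw [coeff_X_mul, smul_comm]
    | add y z hy hz =>
      simp only [map_add, Finsupp.add_apply, smul_add, hy, hz]
      abel
  have hstep (k : ℕ) : c x k = (X : Polynomial ℂ) • c x (k + 1) := by
    have := hc x k
    rw [hx, map_zero, Finsupp.zero_apply] at this
    exact sub_eq_zero.mp this.symm
  have hiter (k j : ℕ) : c x k = (X : Polynomial ℂ) ^ j • c x (k + j) := by
    induction j with
    | zero => simp
    | succ j ih => rw [ih, hstep, smul_smul, ← pow_succ, add_assoc]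
  obtain ⟨N, hN⟩ := (c x).support.bddAbove
  refine c.map_eq_zero_iff.mp (Finsupp.ext fun k => ?_)
  rw [hiter k (N + 1), Finsupp.notMem_support_iff.mp, smul_zero, Finsupp.zero_apply]
  intro h
  have := hN h
  omega

variable {A} in
lemma exists_pow_smul_ker_Udiff_eq_zero (hA : StandardRankOne A) :
    ∃ n : ℕ, ∀ x : LinearMap.ker (Udiff A B), (X : Polynomial ℂ) ^ n • x = 0 := by
  obtain ⟨φ, s, hs, hker⟩ := hA.exists_splitting
  obtain ⟨-, ⟨n, hn⟩, -⟩ := hA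
  let Φ : A ⊗[ℂ] B →ₗ[Polynomial ℂ] Polynomial ℂ ⊗[ℂ] B :=
    TensorProduct.AlgebraTensorModule.map φ (LinearMap.id : B →ₗ[ℂ] B)
  let S : Polynomial ℂ ⊗[ℂ] B →ₗ[Polynomial ℂ] A ⊗[ℂ] B :=
    TensorProduct.AlgebraTensorModule.map s (LinearMap.id : B →ₗ[ℂ] B)
  have hΦ (x : A ⊗[ℂ] B) : Udiff (Polynomial ℂ) B (Φ x) = Φ (Udiff A B x) := by
    induction x with
    | zero => simp
    | tmul a b => simp [Φ, TensorProduct.AlgebraTensorModule.map_tmul]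
    | add x y hx hy => simp only [map_add, hx, hy]
  have hS (x : A ⊗[ℂ] B) : (X : Polynomial ℂ) ^ n • x = (X : Polynomial ℂ) ^ n • S (Φ x) := by
    induction x with
    | zero => simp
    | tmul a b =>
      have ha : (X : Polynomial ℂ) ^ n • a = (X : Polynomial ℂ) ^ n • s (φ a) := by
        rw [← sub_eq_zero, ← smul_sub]
        exact hn _ (hker _ (by rw [map_sub, hs, sub_self]))
      simp only [S, Φ, TensorProduct.AlgebraTensorModule.map_tmul, LinearMap.id_apply,
        TensorProduct.smul_tmul', ha]
    | add x y hx hy => simp only [map_add, smul_add, hx, hy]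
  refine ⟨n, fun ⟨x, hx⟩ => Subtype.ext ?_⟩
  have h0 : Φ x = 0 := by
    apply Udiff_polynomial_injective B
    rw [hΦ, LinearMap.mem_ker.mp hx, map_zero, map_zero]
  change (X : Polynomial ℂ) ^ n • x = 0
  rw [hS, h0, map_zero, smul_zero]

end Tilde

variable (A B : Type)
  [AddCommGroup A] [Module ℂ A] [Module (Polynomial ℂ) A] [IsScalarTower ℂ (Polynomial ℂ) A]
  [AddCommGroup B] [Module ℂ B] [Module (Polynomial ℂ) B] [IsScalarTower ℂ (Polynomial ℂ) B]

/-- For standard rank-one `ℂ[U]`-modules `A` and `B`,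
`ord_U (coker (U₁ - U₂)) ≥ max (ord_U A) (ord_U B)`, and in particular
`ord_U (A ⊗̃ B) ≥ max (ord_U A) (ord_U B)`. -/
theorem ordU_tildeTensor_ge (hA : StandardRankOne A) (hB : StandardRankOne B) :
    max (ordU A) (ordU B) ≤ ordU (CokerUdiff A B) ∧
    max (ordU A) (ordU B) ≤ ordU (TildeTensor A B) := by
  have := hA.1
  have := hB.1
  have : IsNoetherian (Polynomial ℂ) (CokerUdiff A B) :=
    isNoetherian_of_linearEquiv (cokerUdiffEquiv A B).symm
  have hbdd := bddAbove_ordSet (CokerUdiff A B)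
  have hcoker : max (ordU A) (ordU B) ≤ ordU (CokerUdiff A B) := by
    obtain ⟨f, hf⟩ := hB.exists_injective_tensor_right A
    obtain ⟨g, hg⟩ := hA.exists_injective_tensor_right B
    exact max_le
      (ordU_le_of_injective ((cokerUdiffEquiv A B).symm.toLinearMap ∘ₗ f)
        ((cokerUdiffEquiv A B).symm.injective.comp hf) hbdd)
      (ordU_le_of_injective
        ((TensorProduct.comm (Polynomial ℂ) B A ≪≫ₗ (cokerUdiffEquiv A B).symm).toLinearMap ∘ₗ g)
        ((TensorProduct.comm (Polynomial ℂ) B A ≪≫ₗ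
          (cokerUdiffEquiv A B).symm).injective.comp hg) hbdd)
  obtain ⟨n, hn⟩ := exists_pow_smul_ker_Udiff_eq_zero B hA
  exact ⟨hcoker, hcoker.trans (ordU_le_of_injective (LinearMap.inr _ _ _)
    LinearMap.inr_injective (bddAbove_ordSet_prod hn hbdd))⟩

end
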